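/- arXiv:1605.02341 — 3 statements merged into one kernel-verified Lean document; each statement's English description precedes it below -/
import Mathlib

section
/- A point x* ∈ ℝⁿ minimizes the LASSO objective φ(x) = (1/2)‖Ax − y‖₂² + λ‖x‖₁ if and only if for every index i: (Aᵀ(Ax* − y))_i = −λ·sign(x*_i) whenever x*_i ≠ 0, and |(Aᵀ(Ax* − y))_i| ≤ λ whenever x*_i = 0. -/
open Matrix

theorem nonneg_of_forall_small_quadratic_nonneg {h c r : ℝ} (hc : 0 ≤ c) (hr : 0 < r)
    (H : ∀ s, 0 < s → s ≤ r → 0 ≤ h * s + c * s ^ 2) : 0 ≤ h := by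
  by_contra! hneg
  have hs : 0 < min r (-h / (2 * (c + 1))) :=
    lt_min hr (div_pos (by linarith) (by linarith))
  have key := H _ hs (min_le_left _ _)
  have hle : min r (-h / (2 * (c + 1))) * (2 * (c + 1)) ≤ -h :=
    (le_div_iff₀ (by linarith)).1 (min_le_right _ _)
  generalize min r (-h / (2 * (c + 1))) = s at *
  nlinarith [mul_pos hs hs, mul_nonneg hc hs.le]

theorem sign_condition_of_forall_nonneg {g c lam a : ℝ} (hc : 0 ≤ c)
    (H : ∀ s, 0 ≤ g * s + c * s ^ 2 + lam * (|a + s| - |a|)) :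
    (a ≠ 0 → g = -lam * Real.sign a) ∧ (a = 0 → |g| ≤ lam) := by
  refine ⟨fun ha => ?_, ?_⟩
  · rcases lt_or_gt_of_ne ha with ha | ha
    · rw [Real.sign_of_neg ha]
      have h₁ : 0 ≤ g - lam :=
        nonneg_of_forall_small_quadratic_nonneg hc (neg_pos.2 ha) fun s hs hsr => by
          have := H s
          rw [abs_of_nonpos (by linarith : a + s ≤ 0), abs_of_neg ha] at this
          linarith
      have h₂ : 0 ≤ lam - g :=
        nonneg_of_forall_small_quadratic_nonneg hc (neg_pos.2 ha) fun s hs hsr => by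
          have := H (-s)
          rw [abs_of_nonpos (by linarith : a + -s ≤ 0), abs_of_neg ha] at this
          linarith
      linarith
    · rw [Real.sign_of_pos ha]
      have h₁ : 0 ≤ g + lam :=
        nonneg_of_forall_small_quadratic_nonneg hc ha fun s hs hsr => by
          have := H s
          rw [abs_of_nonneg (by linarith : 0 ≤ a + s), abs_of_pos ha] at this
          linarith
      have h₂ : 0 ≤ -lam - g :=
        nonneg_of_forall_small_quadratic_nonneg hc ha fun s hs hsr => by
          have := H (-s)
          rw [abs_of_nonneg (by linarith : 0 ≤ a + -s), abs_of_pos ha] at this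
          linarith
      linarith
  · rintro rfl
    have h₁ : 0 ≤ g + lam :=
      nonneg_of_forall_small_quadratic_nonneg hc one_pos fun s hs _ => by
        have := H s
        rw [zero_add, abs_of_pos hs, abs_zero] at this
        linarith
    have h₂ : 0 ≤ lam - g :=
      nonneg_of_forall_small_quadratic_nonneg hc one_pos fun s hs _ => by
        have := H (-s)
        rw [zero_add, abs_neg, abs_of_pos hs, abs_zero] at this
        linarith
    exact abs_le.2 ⟨by linarith, by linarith⟩

theorem nonneg_of_sign_condition {g lam a : ℝ} (hlam : 0 ≤ lam)
    (h₁ : a ≠ 0 → g = -lam * Real.sign a) (h₂ : a = 0 → |g| ≤ lam) (d : ℝ) :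
    0 ≤ g * d + lam * (|a + d| - |a|) := by
  rcases lt_trichotomy a 0 with ha | rfl | ha
  · rw [h₁ ha.ne, Real.sign_of_neg ha, abs_of_neg ha]
    nlinarith [neg_abs_le (a + d)]
  · have := mul_le_mul_of_nonneg_right (h₂ rfl) (abs_nonneg d)
    rw [← abs_mul] at this
    rw [zero_add, abs_zero, sub_zero]
    linarith [neg_abs_le (g * d)]
  · rw [h₁ ha.ne', Real.sign_of_pos ha, abs_of_pos ha]
    nlinarith [le_abs_self (a + d)]

theorem sum_sq_residual_add {m n : ℕ} (A : Matrix (Fin m) (Fin n) ℝ) (y : Fin m → ℝ)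
    (x d : Fin n → ℝ) :
    (1 / 2) * ∑ j, (A.mulVec (x + d) j - y j) ^ 2 =
      (1 / 2) * ∑ j, (A.mulVec x j - y j) ^ 2 +
        ∑ i, Aᵀ.mulVec (A.mulVec x - y) i * d i + (1 / 2) * ∑ j, (A.mulVec d j) ^ 2 := by
  have hgrad : ∑ i, Aᵀ.mulVec (A.mulVec x - y) i * d i =
      ∑ j, (A.mulVec x j - y j) * A.mulVec d j := by
    change Aᵀ.mulVec (A.mulVec x - y) ⬝ᵥ d = (A.mulVec x - y) ⬝ᵥ A.mulVec d
    rw [Matrix.mulVec_transpose, Matrix.dotProduct_mulVec]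
  rw [hgrad, Finset.mul_sum, Finset.mul_sum, Finset.mul_sum, ← Finset.sum_add_distrib,
    ← Finset.sum_add_distrib]
  refine Finset.sum_congr rfl fun j _ => ?_
  rw [Matrix.mulVec_add, Pi.add_apply]
  ring

/-- `x*` minimizes the LASSO objective
`φ(x) = (1/2)‖Ax - y‖₂² + λ‖x‖₁` iff for every index `i`:
`(Aᵀ(Ax* - y))_i = -λ·sign(x*_i)` whenever `x*_i ≠ 0`, and
`|(Aᵀ(Ax* - y))_i| ≤ λ` whenever `x*_i = 0`. -/
theorem stmt_2 {m n : ℕ} (A : Matrix (Fin m) (Fin n) ℝ) (y : Fin m → ℝ)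
    (lam : ℝ) (hlam : 0 < lam) (x : Fin n → ℝ) :
    (∀ w : Fin n → ℝ,
        (1 / 2) * ∑ j, (A.mulVec x j - y j) ^ 2 + lam * ∑ i, |x i| ≤
          (1 / 2) * ∑ j, (A.mulVec w j - y j) ^ 2 + lam * ∑ i, |w i|) ↔
      (∀ i,
        (x i ≠ 0 → Aᵀ.mulVec (A.mulVec x - y) i = -lam * Real.sign (x i)) ∧
        (x i = 0 → |Aᵀ.mulVec (A.mulVec x - y) i| ≤ lam)) := by
  constructor
  · intro H i
    refine sign_condition_of_forall_nonneg (c := (1 / 2) * ∑ j, A j i ^ 2)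
      (by positivity) fun s => ?_
    have hw := H (x + Pi.single i s)
    rw [sum_sq_residual_add] at hw
    have hlin : ∑ k, Aᵀ.mulVec (A.mulVec x - y) k * (Pi.single i s : Fin n → ℝ) k =
        Aᵀ.mulVec (A.mulVec x - y) i * s :=
      dotProduct_single _ _ _
    have hquad : ∑ j, (A.mulVec (Pi.single i s) j) ^ 2 = (∑ j, A j i ^ 2) * s ^ 2 := by
      rw [Finset.sum_mul]
      refine Finset.sum_congr rfl fun j _ => ?_
      rw [← mul_pow]
      exact congrArg (· ^ 2) (dotProduct_single _ _ _)
    have habs : ∑ k, |(x + Pi.single i s : Fin n → ℝ) k| - ∑ k, |x k| = |x i + s| - |x i| := by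
      rw [← Finset.sum_sub_distrib, Finset.sum_eq_single i]
      · simp
      · intro k _ hk
        simp [hk]
      · simp
    rw [hlin, hquad] at hw
    rw [← habs]
    linarith
  · intro H w
    obtain ⟨d, rfl⟩ : ∃ d, w = x + d := ⟨w - x, by simp⟩
    rw [sum_sq_residual_add]
    have hsum : 0 ≤ ∑ i, (Aᵀ.mulVec (A.mulVec x - y) i * d i + lam * (|x i + d i| - |x i|)) :=
      Finset.sum_nonneg fun i _ => nonneg_of_sign_condition hlam.le (H i).1 (H i).2 (d i)
    rw [Finset.sum_add_distrib, ← Finset.mul_sum, Finset.sum_sub_distrib] at hsum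
    have hquad : 0 ≤ ∑ j, (A.mulVec d j) ^ 2 := by positivity
    simp only [Pi.add_apply]
    linarith
end

section
/- Let γ > 0, x ∈ ℝⁿ, α = α(x), β = β(x), and let P be the diagonal n×n matrix with P_ii = 1 for i ∈ α and P_ii = 0 for i ∈ β. Then the matrix H = I − P(I − γAᵀA) is invertible if and only if the columns of A indexed by α are linearly independent (equivalently, the Gram matrix A_αᵀA_α is invertible). -/
open Matrix
open scoped Classical

/-- Gradient of the LASSO smooth part, `∇f(x) = Aᵀ(Ax - y)`. -/
def gradf {m n : ℕ} (A : Matrix (Fin m) (Fin n) ℝ) (y : Fin m → ℝ)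
    (x : Fin n → ℝ) : Fin n → ℝ :=
  Aᵀ.mulVec (A.mulVec x - y)

/-- The active index set `α(x) = {i : |x_i - γ∇f(x)_i| > γλ}`. -/
def activeIdx {m n : ℕ} (A : Matrix (Fin m) (Fin n) ℝ) (y : Fin m → ℝ)
    (lam γ : ℝ) (x : Fin n → ℝ) (i : Fin n) : Prop :=
  γ * lam < |x i - γ * gradf A y x i|

/-- The columns of a real matrix are linearly independent iff its Gram matrix is invertible. -/
theorem linearIndependent_col_iff_isUnit_transpose_mul_self {m κ : Type*} [Fintype m] [Fintype κ]
    [DecidableEq κ] (B : Matrix m κ ℝ) :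
    LinearIndependent ℝ B.col ↔ IsUnit (Bᵀ * B) := by
  rw [← mulVec_injective_iff, ← mulVec_injective_iff_isUnit, ← coe_mulVecLin, ← coe_mulVecLin,
    ← LinearMap.ker_eq_bot, ← LinearMap.ker_eq_bot, ker_mulVecLin_transpose_mul_self]

/-- `I - P(I - γG)`, with `P` the diagonal projection onto the coordinates satisfying `p`, is
invertible iff the principal submatrix of `G` indexed by `p` is. -/
theorem isUnit_one_sub_diagonal_mul_iff {K ι : Type*} [Field K] [Fintype ι] [DecidableEq ι]
    (G : Matrix ι ι K) (p : ι → Prop) [DecidablePred p] {γ : K} (hγ : γ ≠ 0) :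
    IsUnit (1 - (diagonal fun i => if p i then (1 : K) else 0) * (1 - γ • G)) ↔
      IsUnit (G.submatrix (Subtype.val : {i // p i} → ι) (Subtype.val : {i // p i} → ι)) := by
  set H := 1 - (diagonal fun i => if p i then (1 : K) else 0) * (1 - γ • G) with hH
  have inactive : ∀ i, ¬p i → ∀ j, H i j = (1 : Matrix ι ι K) i j := fun i hi j => by
    simp [hH, hi]
  have hzero : ∀ i, ¬p i → ∀ j, p j → H i j = 0 := fun i hi j hj => by
    rw [inactive i hi, one_apply_ne]
    rintro rfl
    exact hi hj
  have hact : H.toSquareBlockProp p =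
      γ • G.submatrix (Subtype.val : {i // p i} → ι) (Subtype.val : {i // p i} → ι) := by
    ext i j
    simp [hH, toSquareBlockProp_def, i.2]
  have hinact : (H.toSquareBlockProp fun i => ¬p i) = 1 := by
    ext i j
    simp [toSquareBlockProp_def, inactive i i.2, one_apply, Subtype.ext_iff]
  rw [isUnit_iff_isUnit_det, isUnit_iff_isUnit_det, twoBlockTriangular_det H p hzero, hact, hinact,
    det_one, mul_one, det_smul]
  simp [hγ]

/-- Let `α = α(x) = {i : |x_i - γ∇f(x)_i| > γλ}` and let `P` be the diagonal
matrix with `P_ii = 1` for `i ∈ α` and `P_ii = 0` otherwise. Then `H = I - P(I - γAᵀA)` is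
invertible iff the columns of `A` indexed by `α` are linearly independent, equivalently iff
the Gram matrix `A_αᵀ A_α` is invertible. -/
theorem stmt_15 {m n : ℕ} (A : Matrix (Fin m) (Fin n) ℝ) (y : Fin m → ℝ)
    (lam γ : ℝ) (hlam : 0 < lam) (hγ : 0 < γ) (x : Fin n → ℝ) :
    (IsUnit
        ((1 : Matrix (Fin n) (Fin n) ℝ) -
          (Matrix.diagonal fun i => if activeIdx A y lam γ x i then (1 : ℝ) else 0) *
            ((1 : Matrix (Fin n) (Fin n) ℝ) - γ • (Aᵀ * A))) ↔
      LinearIndependent ℝ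
        (fun i : {i : Fin n // activeIdx A y lam γ x i} => Aᵀ (i : Fin n))) ∧
    (LinearIndependent ℝ
        (fun i : {i : Fin n // activeIdx A y lam γ x i} => Aᵀ (i : Fin n)) ↔
      IsUnit
        ((Aᵀ * A).submatrix
          (Subtype.val : {i : Fin n // activeIdx A y lam γ x i} → Fin n)
          (Subtype.val : {i : Fin n // activeIdx A y lam γ x i} → Fin n))) := by
  have gram := linearIndependent_col_iff_isUnit_transpose_mul_self
    (A.submatrix id (Subtype.val : {i : Fin n // activeIdx A y lam γ x i} → Fin n))
  exact ⟨(isUnit_one_sub_diagonal_mul_iff (Aᵀ * A) _ hγ.ne').trans gram.symm, gram⟩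
end

section
/- Let γ > 0, x ∈ ℝⁿ, α = α(x), β = β(x), and suppose the columns of A indexed by α are linearly independent. Let d ∈ ℝⁿ be the unique vector satisfying the Newton system d_β = −(R_γ(x))_β and γA_αᵀA_α d_α = −(R_γ(x))_α − γA_αᵀA_β d_β. Then the Newton iterate x⁺ = x + d satisfies x⁺_i = 0 for all i ∈ β and A_αᵀA_α x⁺_α = A_αᵀy − λ·s_α(x), where s_i(x) = sign(x_i − γ(∇f(x))_i). -/
open Matrix
open scoped Classical

/-- The soft-thresholding operator `S_κ` on `ℝⁿ`. -/
noncomputable def softThresh {n : ℕ} (κ : ℝ) (z : Fin n → ℝ) : Fin n → ℝ :=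
  fun i => Real.sign (z i) * max (|z i| - κ) 0

/-- The fixed-point residual `R_γ(x) = x - S_{γλ}(x - γ∇f(x))`. -/
noncomputable def fbRes {m n : ℕ} (A : Matrix (Fin m) (Fin n) ℝ) (y : Fin m → ℝ)
    (lam γ : ℝ) (x : Fin n → ℝ) : Fin n → ℝ :=
  x - softThresh (γ * lam) (x - γ • gradf A y x)

/-- Soft-thresholding vanishes at coordinates of magnitude at most the threshold. -/
theorem softThresh_of_abs_le {n : ℕ} {κ : ℝ} {z : Fin n → ℝ} {i : Fin n} (h : |z i| ≤ κ) :
    softThresh κ z i = 0 := by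
  simp [softThresh, max_eq_right (sub_nonpos.2 h)]

/-- Soft-thresholding shifts coordinates of magnitude at least the threshold towards zero. -/
theorem softThresh_of_le_abs {n : ℕ} {κ : ℝ} {z : Fin n → ℝ} {i : Fin n} (h : κ ≤ |z i|) :
    softThresh κ z i = z i - κ * Real.sign (z i) := by
  have hs : Real.sign (z i) * |z i| = z i := by
    rcases lt_trichotomy (z i) 0 with hz | hz | hz
    · simp [Real.sign_of_neg hz, abs_of_neg hz]
    · simp [hz]
    · simp [Real.sign_of_pos hz, abs_of_pos hz]
  rw [softThresh, max_eq_left (sub_nonneg.2 h), mul_sub, hs, mul_comm κ]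

theorem gradf_apply {m n : ℕ} (A : Matrix (Fin m) (Fin n) ℝ) (y : Fin m → ℝ)
    (x : Fin n → ℝ) (i : Fin n) :
    gradf A y x i = ∑ j, (Aᵀ * A) i j * x j - Aᵀ.mulVec y i := by
  rw [gradf, Matrix.mulVec_sub, Matrix.mulVec_mulVec]
  rfl

/-- Suppose the columns of `A` indexed by `α = α(x)` are linearly independent
and `d` satisfies the Newton system `d_β = -(R_γ(x))_β`,
`γ A_αᵀA_α d_α = -(R_γ(x))_α - γ A_αᵀA_β d_β`. Then the Newton iterate `x⁺ = x + d`
satisfies `x⁺_i = 0` for `i ∈ β` and `A_αᵀA_α x⁺_α = A_αᵀ y - λ s_α(x)`, where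
`s_i(x) = sign (x_i - γ∇f(x)_i)`. -/
theorem stmt_16 {m n : ℕ} (A : Matrix (Fin m) (Fin n) ℝ) (y : Fin m → ℝ)
    (lam γ : ℝ) (hlam : 0 < lam) (hγ : 0 < γ) (x d : Fin n → ℝ)
    (hli : LinearIndependent ℝ
      (fun i : {i : Fin n // activeIdx A y lam γ x i} => Aᵀ (i : Fin n)))
    (hdβ : ∀ i, ¬ activeIdx A y lam γ x i → d i = -(fbRes A y lam γ x i))
    (hdα : ∀ i, activeIdx A y lam γ x i →
      γ * ∑ j ∈ Finset.univ.filter (activeIdx A y lam γ x), (Aᵀ * A) i j * d j =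
        -(fbRes A y lam γ x i) -
          γ * ∑ j ∈ Finset.univ.filter (fun j => ¬ activeIdx A y lam γ x j),
            (Aᵀ * A) i j * d j) :
    (∀ i, ¬ activeIdx A y lam γ x i → x i + d i = 0) ∧
      (∀ i, activeIdx A y lam γ x i →
        ∑ j ∈ Finset.univ.filter (activeIdx A y lam γ x), (Aᵀ * A) i j * (x j + d j) =
          Aᵀ.mulVec y i - lam * Real.sign (x i - γ * gradf A y x i)) := by
  have hβ : ∀ i, ¬ activeIdx A y lam γ x i → x i + d i = 0 := by
    intro i hi
    rw [hdβ i hi, fbRes, Pi.sub_apply, softThresh_of_abs_le (not_lt.1 hi)]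
    ring
  refine ⟨hβ, fun i hi => ?_⟩
  have hR : fbRes A y lam γ x i = γ * gradf A y x i
      + γ * lam * Real.sign (x i - γ * gradf A y x i) := by
    rw [fbRes, Pi.sub_apply, softThresh_of_le_abs (le_of_lt hi)]
    simp only [Pi.sub_apply, Pi.smul_apply, smul_eq_mul]
    ring
  have hsum : ∑ j ∈ Finset.univ.filter (fun j => ¬ activeIdx A y lam γ x j),
      (Aᵀ * A) i j * (x j + d j) = 0 :=
    Finset.sum_eq_zero fun j hj => by rw [hβ j (Finset.mem_filter.1 hj).2, mul_zero]
  have hsplit := Finset.sum_filter_add_sum_filter_not Finset.univ (activeIdx A y lam γ x)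
    (fun j => (Aᵀ * A) i j * x j)
  have hd := hdα i hi
  have hg := gradf_apply A y x i
  simp only [mul_add, Finset.sum_add_distrib] at hsum ⊢
  refine mul_left_cancel₀ hγ.ne' ?_
  linear_combination hd - hR - γ * hg + γ * hsplit - γ * hsum
end
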